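/- Let m ≥ 2 be an integer and h > 0. For every integer k with 0 ≤ k ≤ 2m the series ∑_{β∈ℤ} D_m[β]·(hβ)^k converges absolutely, and ∑_{β∈ℤ} D_m[β]·(hβ)^k = 0 for 0 ≤ k ≤ 2m−1, while ∑_{β∈ℤ} D_m[β]·(hβ)^{2m} = (2m)!. -/

import Mathlib

/-- The Euler–Frobenius coefficient `a_s^{(k)}`. -/
noncomputable def eulerCoeff (k s : ℕ) : ℝ :=
  ∑ j ∈ Finset.range (s + 1),
    (-1 : ℝ) ^ j * (Nat.choose (k + 2) j : ℝ) * ((s + 1 - j : ℕ) : ℝ) ^ (k + 1)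

/-- The Euler–Frobenius polynomial `E_k`. -/
noncomputable def eulerPoly (k : ℕ) : Polynomial ℝ :=
  ∑ s ∈ Finset.range (k + 1), Polynomial.C (eulerCoeff k s) * Polynomial.X ^ s

/-- The set `Λ` of real roots of `E_{2m-2}` of modulus less than `1`. -/
noncomputable def smallRoots (m : ℕ) : Finset ℝ :=
  (eulerPoly (2 * m - 2)).roots.toFinset.filter (fun x => |x| < 1)

/-- The discrete analogue `D_m[β]` of the operator `d^{2m}/dx^{2m}`. -/
noncomputable def Dm (m : ℕ) (h : ℝ) (β : ℤ) : ℝ :=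
  (((2 * m - 1).factorial : ℝ) / h ^ (2 * m)) *
    (if β = 0 then
      -(2 : ℝ) ^ (2 * m - 1) +
        ∑ l ∈ smallRoots m, (1 - l) ^ (2 * m + 1) / (l * (eulerPoly (2 * m - 1)).eval l)
    else if β.natAbs = 1 then
      1 + ∑ l ∈ smallRoots m, (1 - l) ^ (2 * m + 1) / (eulerPoly (2 * m - 1)).eval l
    else
      ∑ l ∈ smallRoots m,
        (1 - l) ^ (2 * m + 1) * l ^ β.natAbs / (l * (eulerPoly (2 * m - 1)).eval l))


section EulerFrobenius

open Polynomial

lemma cast_choose_succ_mul (n j : ℕ) :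
    (n.choose (j + 1) : ℝ) * (j + 1) = n.choose j * (n - j) := by
  rcases le_or_gt j n with hj | hj
  · have := Nat.choose_succ_right_eq n j
    rw [← Nat.cast_sub hj]
    exact_mod_cast this
  · simp [Nat.choose_eq_zero_of_lt hj, Nat.choose_eq_zero_of_lt (hj.trans (Nat.lt_succ_self j))]

lemma eulerCoeff_zero_right (k : ℕ) : eulerCoeff k 0 = 1 := by
  simp [eulerCoeff]

lemma eulerCoeff_one_right (k : ℕ) : eulerCoeff k 1 = 2 ^ (k + 1) - (k + 2) := by
  simp [eulerCoeff, Finset.sum_range_succ, sub_eq_add_neg]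

lemma eulerCoeff_succ_succ (k s : ℕ) :
    eulerCoeff (k + 1) (s + 1) =
      (s + 2) * eulerCoeff k (s + 1) + (k + 1 - s) * eulerCoeff k s := by
  unfold eulerCoeff
  rw [Finset.sum_range_succ', Finset.sum_range_succ' _ (s + 1), mul_add, Finset.mul_sum,
    Finset.mul_sum, add_right_comm (Finset.sum _ _), ← Finset.sum_add_distrib]
  congr 1
  · refine Finset.sum_congr rfl fun j hj => ?_
    have hj' : j ≤ s + 1 := (Finset.mem_range.1 hj).le
    have h := cast_choose_succ_mul (k + 2) j
    have hp : ((k + 1 + 2).choose (j + 1) : ℝ) = (k + 2).choose j + (k + 2).choose (j + 1) := by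
      exact_mod_cast Nat.choose_succ_succ (k + 2) j
    rw [Nat.add_sub_add_right, hp, Nat.cast_sub hj']
    push_cast at h ⊢
    linear_combination (-1 : ℝ) ^ j * ((s : ℝ) + 1 - j) ^ (k + 1) * h
  · push_cast
    simp
    ring

lemma eulerCoeff_eq_zero {k s : ℕ} (h : k < s) : eulerCoeff k s = 0 := by
  induction k generalizing s with
  | zero =>
    obtain ⟨s, rfl⟩ := Nat.exists_eq_add_of_lt h
    rw [show 0 + s + 1 = s + 1 by ring]
    unfold eulerCoeff
    rcases s with _ | s
    · norm_num [Finset.sum_range_succ]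
    · rw [Finset.sum_range_succ', Finset.sum_range_succ', Finset.sum_range_succ',
        Finset.sum_eq_zero]
      · have h1 : s + 1 + 1 + 1 - (0 + 1 + 1) = s + 1 := by omega
        have h2 : s + 1 + 1 + 1 - (0 + 1) = s + 2 := by omega
        simp only [h1, h2]
        push_cast
        simp
        ring
      · intro j _
        rw [Nat.choose_eq_zero_of_lt (by omega)]
        simp
  | succ k ih =>
    obtain ⟨s, rfl⟩ : ∃ t, s = t + 1 := ⟨s - 1, by omega⟩
    rw [eulerCoeff_succ_succ, ih (by omega), ih (by omega)]
    simp

lemma eulerCoeff_symm {k s t : ℕ} (h : s + t = k) : eulerCoeff k s = eulerCoeff k t := by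
  induction k generalizing s t with
  | zero =>
    obtain ⟨rfl, rfl⟩ : s = 0 ∧ t = 0 := by omega
    rfl
  | succ k ih =>
    have key (t : ℕ) (ht : t = k + 1) : eulerCoeff (k + 1) t = 1 := by
      rw [ht, eulerCoeff_succ_succ, eulerCoeff_eq_zero (Nat.lt_succ_self k),
        ← ih (Nat.zero_add k), eulerCoeff_zero_right]
      ring
    rcases s with _ | s
    · rw [eulerCoeff_zero_right, key t (by omega)]
    rcases t with _ | t
    · rw [eulerCoeff_zero_right, key (s + 1) (by omega)]
    rw [eulerCoeff_succ_succ, eulerCoeff_succ_succ, ih (show (s + 1) + t = k by omega),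
      ih (show s + (t + 1) = k by omega)]
    have hk : (s : ℝ) + t + 1 = k := by exact_mod_cast (by omega : s + t + 1 = k)
    rw [← hk]
    ring

lemma coeff_eulerPoly (k s : ℕ) : (eulerPoly k).coeff s = eulerCoeff k s := by
  simp only [eulerPoly, finsetSum_coeff, coeff_C_mul, coeff_X_pow, mul_ite, mul_one, mul_zero,
    Finset.sum_ite_eq, Finset.mem_range]
  split_ifs with h
  · rfl
  · rw [eulerCoeff_eq_zero (by omega)]

lemma eulerPoly_succ (k : ℕ) :
    eulerPoly (k + 1) =
      (1 + C ((k : ℝ) + 1) * X) * eulerPoly k + X * (1 - X) * derivative (eulerPoly k) := by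
  have e : (1 + C ((k : ℝ) + 1) * X) * eulerPoly k + X * (1 - X) * derivative (eulerPoly k) =
      eulerPoly k + X * (C ((k : ℝ) + 1) * eulerPoly k + derivative (eulerPoly k)
        - X * derivative (eulerPoly k)) := by ring
  rw [e]
  ext s
  rcases s with _ | s
  · simp [coeff_eulerPoly, eulerCoeff_zero_right]
  · rw [coeff_add, coeff_X_mul, coeff_sub, coeff_add, coeff_C_mul, coeff_derivative,
      coeff_eulerPoly, coeff_eulerPoly, coeff_eulerPoly, eulerCoeff_succ_succ]
    rcases s with _ | s
    · simp
      ring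
    · rw [coeff_X_mul, coeff_derivative, coeff_eulerPoly]
      push_cast
      ring

lemma natDegree_eulerPoly_le (k : ℕ) : (eulerPoly k).natDegree ≤ k :=
  natDegree_le_iff_coeff_eq_zero.2 fun _ h => by rw [coeff_eulerPoly, eulerCoeff_eq_zero h]

lemma eulerPoly_eval_zero (k : ℕ) : (eulerPoly k).eval 0 = 1 := by
  rw [← coeff_zero_eq_eval_zero, coeff_eulerPoly, eulerCoeff_zero_right]

lemma eulerPoly_ne_zero (k : ℕ) : eulerPoly k ≠ 0 := fun h => by
  simpa [h] using eulerPoly_eval_zero k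

lemma eulerPoly_eval_one (k : ℕ) : (eulerPoly k).eval 1 = (k + 1).factorial := by
  induction k with
  | zero => simp [eulerPoly, eulerCoeff]
  | succ k ih =>
    rw [eulerPoly_succ, Nat.factorial_succ (k + 1)]
    simp [ih, add_comm]

lemma eulerPoly_succ_eval_of_root {k : ℕ} {x : ℝ} (hx : (eulerPoly k).eval x = 0) :
    (eulerPoly (k + 1)).eval x = x * (1 - x) * (derivative (eulerPoly k)).eval x := by
  rw [eulerPoly_succ]
  simp [hx]

lemma pow_mul_eulerPoly_eval_inv (k : ℕ) {x : ℝ} (hx : x ≠ 0) :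
    x ^ k * (eulerPoly k).eval x⁻¹ = (eulerPoly k).eval x := by
  simp only [eulerPoly, eval_finsetSum, eval_mul, eval_C, eval_pow, eval_X]
  rw [Finset.mul_sum, ← Finset.sum_range_reflect]
  refine Finset.sum_congr rfl fun j hj => ?_
  have hj' : j ≤ k := by simpa [Nat.lt_succ_iff] using hj
  rw [show k + 1 - 1 - j = k - j by omega, eulerCoeff_symm (show k - j + j = k by omega)]
  have : x ^ k = x ^ j * x ^ (k - j) := by rw [← pow_add]; congr 1; omega
  rw [this, inv_pow]
  field_simp

lemma eulerPoly_eval_inv_eq_zero {k : ℕ} {x : ℝ} (hx : (eulerPoly k).eval x = 0) :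
    (eulerPoly k).eval x⁻¹ = 0 := by
  have h0 : x ≠ 0 := by
    rintro rfl
    simp [eulerPoly_eval_zero] at hx
  have := pow_mul_eulerPoly_eval_inv k h0
  rw [hx] at this
  exact (mul_eq_zero.1 this).resolve_left (pow_ne_zero _ h0)

lemma eulerPoly_derivative_eval_inv {k : ℕ} {x : ℝ} (hx : (eulerPoly k).eval x = 0) :
    x ^ k * (derivative (eulerPoly k)).eval x⁻¹ =
      -(x ^ 2 * (derivative (eulerPoly k)).eval x) := by
  have h0 : x ≠ 0 := by
    rintro rfl
    simp [eulerPoly_eval_zero] at hx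
  have h1 : HasDerivAt (fun y : ℝ => y ^ k * (eulerPoly k).eval y⁻¹)
      (k * x ^ (k - 1) * (eulerPoly k).eval x⁻¹ +
        x ^ k * ((derivative (eulerPoly k)).eval x⁻¹ * -(x ^ 2)⁻¹)) x :=
    (hasDerivAt_pow k x).mul
      (((eulerPoly k).hasDerivAt x⁻¹).comp x (hasDerivAt_inv h0))
  have h2 : HasDerivAt (fun y : ℝ => y ^ k * (eulerPoly k).eval y⁻¹)
      ((derivative (eulerPoly k)).eval x) x := by
    refine ((eulerPoly k).hasDerivAt x).congr_of_eventuallyEq ?_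
    filter_upwards [isOpen_ne.mem_nhds h0] with y hy using pow_mul_eulerPoly_eval_inv k hy
  rw [← h1.unique h2, eulerPoly_eval_inv_eq_zero hx]
  field_simp
  ring

/-- The polynomial `(u - 1) u ^ (k + 1) E_k(1 - 1 / u)`. -/
noncomputable def eulerAux : ℕ → ℝ[X]
  | 0 => X * (X - 1)
  | k + 1 => X * (X - 1) * derivative (eulerAux k)

lemma eulerAux_eval (k : ℕ) {u : ℝ} (hu : u ≠ 0) :
    (eulerAux k).eval u = (u - 1) * u ^ (k + 1) * (eulerPoly k).eval (1 - u⁻¹) := by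
  induction k generalizing u with
  | zero =>
    simp [eulerAux, eulerPoly, eulerCoeff]
    ring
  | succ k ih =>
    have h1 : HasDerivAt (fun y : ℝ => (y - 1) * y ^ (k + 1) * (eulerPoly k).eval (1 - y⁻¹))
        ((1 * u ^ (k + 1) + (u - 1) * (((k + 1 : ℕ) : ℝ) * u ^ k)) * (eulerPoly k).eval (1 - u⁻¹) +
          (u - 1) * u ^ (k + 1) *
            ((derivative (eulerPoly k)).eval (1 - u⁻¹) * -(-(u ^ 2)⁻¹))) u :=
      (((hasDerivAt_id u).sub_const 1).mul (hasDerivAt_pow (k + 1) u)).mul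
        (HasDerivAt.comp (h₂ := fun z => (eulerPoly k).eval z) (h := fun y => 1 - y⁻¹) u
          ((eulerPoly k).hasDerivAt (1 - u⁻¹)) ((hasDerivAt_inv hu).const_sub 1))
    have h2 := h1.unique (((eulerAux k).hasDerivAt u).congr_of_eventuallyEq
      (by filter_upwards [isOpen_ne.mem_nhds hu] with y hy using (ih hy).symm))
    rw [eulerAux, eulerPoly_succ]
    simp only [eval_mul, eval_add, eval_sub, eval_X, eval_one, eval_C, ← h2]
    push_cast
    field_simp
    ring

lemma eulerAux_eval_zero (k : ℕ) : (eulerAux k).eval 0 = 0 := by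
  cases k <;> simp [eulerAux]

lemma eulerAux_eval_one (k : ℕ) : (eulerAux k).eval 1 = 0 := by
  cases k <;> simp [eulerAux]

lemma card_roots_eulerAux (k : ℕ) : k + 2 ≤ (eulerAux k).roots.toFinset.card := by
  have key (p : ℝ[X]) (hp : p ≠ 0) (S : Finset ℝ) (hS : ∀ x ∈ S, p.eval x = 0 ∧ x ≠ 0 ∧ x ≠ 1) :
      S.card + 2 ≤ (X * (X - 1) * p).roots.toFinset.card := by
    have h01 : X * (X - 1) * p ≠ 0 :=
      mul_ne_zero (mul_ne_zero X_ne_zero (by simpa using X_sub_C_ne_zero (1 : ℝ))) hp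
    rw [← one_add_one_eq_two, ← add_assoc,
      ← Finset.card_cons (a := (1 : ℝ)) (s := S) (fun h => (hS 1 h).2.2 rfl),
      ← Finset.card_cons (a := (0 : ℝ)) (by simpa using fun h => (hS 0 h).2.1 rfl)]
    refine Finset.card_le_card fun x hx => ?_
    rw [Multiset.mem_toFinset, mem_roots h01, IsRoot.def]
    simp only [Finset.mem_cons] at hx
    rcases hx with rfl | rfl | hx
    · simp
    · simp
    · simp [(hS x hx).1]
  induction k with
  | zero => simpa [eulerAux] using key 1 one_ne_zero ∅ (by simp)
  | succ k ih =>
    have h := (eulerAux k).card_roots_toFinset_le_card_roots_derivative_sdiff_roots_succ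
    have h0 : eulerAux k ≠ 0 := fun h0 => by simp [h0] at ih
    have hd : derivative (eulerAux k) ≠ 0 := fun hd => by
      simp [hd] at h
      omega
    refine le_trans (by omega) (key _ hd
      ((derivative (eulerAux k)).roots.toFinset \ (eulerAux k).roots.toFinset) fun x hx => ?_)
    simp only [Finset.mem_sdiff, Multiset.mem_toFinset, mem_roots hd, mem_roots h0,
      IsRoot.def] at hx
    refine ⟨hx.1, ?_, ?_⟩
    · rintro rfl
      exact hx.2 (eulerAux_eval_zero k)
    · rintro rfl
      exact hx.2 (eulerAux_eval_one k)

lemma le_card_roots_eulerPoly (k : ℕ) : k ≤ (eulerPoly k).roots.toFinset.card := by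
  have h := card_roots_eulerAux k
  have h0 : eulerAux k ≠ 0 := fun h0 => by simp [h0] at h
  have h1 := Finset.pred_card_le_card_erase (s := (eulerAux k).roots.toFinset) (a := 0)
  have h2 := Finset.pred_card_le_card_erase (s := (eulerAux k).roots.toFinset.erase 0) (a := 1)
  refine le_trans (by omega) (Finset.card_le_card_of_injOn
    (s := ((eulerAux k).roots.toFinset.erase 0).erase 1) (fun u => 1 - u⁻¹) ?_ ?_)
  · intro u hu
    simp only [Multiset.mem_toFinset, mem_roots h0, IsRoot.def, Finset.coe_erase,
      Set.mem_sdiff, Set.mem_singleton_iff, Finset.mem_coe] at hu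
    obtain ⟨⟨hu, hu0⟩, hu1⟩ := hu
    rw [eulerAux_eval k hu0] at hu
    simp only [Finset.mem_coe, Multiset.mem_toFinset, mem_roots (eulerPoly_ne_zero k), IsRoot.def]
    exact (mul_eq_zero.1 hu).resolve_left
      (mul_ne_zero (sub_ne_zero.2 hu1) (pow_ne_zero _ hu0))
  · intro u _ v _ huv
    simpa using huv

lemma eulerPoly_derivative_eval_ne_zero {k : ℕ} {x : ℝ} (hx : (eulerPoly k).eval x = 0) :
    (derivative (eulerPoly k)).eval x ≠ 0 := by
  intro hd
  have h1 := (one_lt_rootMultiplicity_iff_isRoot (eulerPoly_ne_zero k)).2 ⟨hx, hd⟩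
  have hn : (eulerPoly k).roots.Nodup := by
    rw [← Multiset.toFinset_card_eq_card_iff_nodup]
    exact le_antisymm (Multiset.toFinset_card_le _) (((card_roots' _).trans
      (natDegree_eulerPoly_le k)).trans (le_card_roots_eulerPoly k))
  have h2 := Multiset.nodup_iff_count_le_one.1 hn x
  rw [count_roots] at h2
  omega

lemma eulerPoly_eval_neg_one_ne_zero {k : ℕ} (hk : Even k) : (eulerPoly k).eval (-1) ≠ 0 := by
  intro h
  have h1 := eulerPoly_derivative_eval_inv h
  rw [hk.neg_one_pow, inv_neg, inv_one] at h1
  exact eulerPoly_derivative_eval_ne_zero h (by linarith)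

lemma exists_eulerPoly_eq_mul {k : ℕ} {x : ℝ} (hx : (eulerPoly k).eval x = 0) (hx1 : |x| < 1) :
    ∃ q : ℝ[X], eulerPoly k = (X - C x) * (1 - C x * X) * q ∧ q.natDegree + 2 ≤ k := by
  have h0 : x ≠ 0 := by
    rintro rfl
    simp [eulerPoly_eval_zero] at hx
  have hne : x ≠ x⁻¹ := fun h => by
    have : x * x = 1 := by
      nth_rw 2 [h]
      exact mul_inv_cancel₀ h0
    nlinarith [abs_lt.1 hx1]
  obtain ⟨q, hq⟩ := (isCoprime_X_sub_C_of_isUnit_sub (sub_ne_zero.2 hne).isUnit).mul_dvd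
    (dvd_iff_isRoot.2 hx) (dvd_iff_isRoot.2 (eulerPoly_eval_inv_eq_zero hx))
  have hq0 : q ≠ 0 := by
    rintro rfl
    exact eulerPoly_ne_zero k (by simpa using hq)
  refine ⟨C (-x⁻¹) * q, ?_, ?_⟩
  · have hC : C x * C x⁻¹ = (1 : ℝ[X]) := by rw [← C_mul, mul_inv_cancel₀ h0, C_1]
    rw [hq, C_neg]
    linear_combination -((X - C x) * q * X * hC)
  · rw [natDegree_C_mul (by simpa using h0)]
    have hd := natDegree_eulerPoly_le k
    rw [hq, natDegree_mul (mul_ne_zero (X_sub_C_ne_zero _) (X_sub_C_ne_zero _)) hq0,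
      natDegree_mul (X_sub_C_ne_zero _) (X_sub_C_ne_zero _), natDegree_X_sub_C,
      natDegree_X_sub_C] at hd
    omega

/-- The polynomial identity behind the partial fraction expansion of
`(1 - z) ^ (n + 2) / (z E_n(z))`. -/
lemma exists_partialFraction {n : ℕ} (hn : Even n) (hn2 : 2 ≤ n) :
    ∃ q : ℝ → ℝ[X],
      (∀ x ∈ (eulerPoly n).roots.toFinset.filter (fun x => |x| < 1),
        eulerPoly n = (X - C x) * (1 - C x * X) * q x) ∧
      X ^ 2 * ∑ x ∈ (eulerPoly n).roots.toFinset.filter (fun x => |x| < 1),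
          C ((1 - x) ^ (n + 3) / (x * (eulerPoly (n + 1)).eval x) * (1 - x ^ 2)) * q x +
        eulerPoly n * (X ^ 2 + 1 - C (2 ^ (n + 1)) * X) = (1 - X) ^ (n + 2) := by
  set Λ := (eulerPoly n).roots.toFinset.filter (fun x => |x| < 1) with hΛ
  have hmem (x : ℝ) : x ∈ Λ ↔ (eulerPoly n).eval x = 0 ∧ |x| < 1 := by
    rw [hΛ, Finset.mem_filter, Multiset.mem_toFinset, mem_roots (eulerPoly_ne_zero n), IsRoot.def]
  have hex (x : ℝ) : ∃ q : ℝ[X],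
      x ∈ Λ → eulerPoly n = (X - C x) * (1 - C x * X) * q ∧ q.natDegree + 2 ≤ n := by
    by_cases hx : x ∈ Λ
    · obtain ⟨q, hq⟩ := exists_eulerPoly_eq_mul ((hmem x).1 hx).1 ((hmem x).1 hx).2
      exact ⟨q, fun _ => hq⟩
    · exact ⟨0, fun h => absurd h hx⟩
  choose q hq using hex
  refine ⟨q, fun x hx => (hq x hx).1, ?_⟩
  set c : ℝ → ℝ := fun x => (1 - x) ^ (n + 3) / (x * (eulerPoly (n + 1)).eval x) * (1 - x ^ 2)
    with hc
  set W : ℝ[X] := X ^ 2 * ∑ x ∈ Λ, C (c x) * q x +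
    eulerPoly n * (X ^ 2 + 1 - C (2 ^ (n + 1)) * X) - (1 - X) ^ (n + 2) with hW
  suffices hW0 : W = 0 from sub_eq_zero.1 hW0
  have hne0 {x : ℝ} (hx : (eulerPoly n).eval x = 0) : x ≠ 0 := by
    rintro rfl
    simp [eulerPoly_eval_zero] at hx
  have hne1 {x : ℝ} (hx : (eulerPoly n).eval x = 0) : x ≠ 1 := by
    rintro rfl
    rw [eulerPoly_eval_one] at hx
    exact (Nat.cast_ne_zero.2 (Nat.factorial_ne_zero _)) hx
  have hsq {x : ℝ} (hx : x ∈ Λ) : 1 - x ^ 2 ≠ 0 := by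
    have := abs_lt.1 ((hmem x).1 hx).2
    nlinarith
  have hcx {x : ℝ} (hx : x ∈ Λ) :
      c x * (x ^ 2 * (derivative (eulerPoly n)).eval x) = (1 - x) ^ (n + 2) * (1 - x ^ 2) := by
    have hr := ((hmem x).1 hx).1
    have h1 : 1 - x ≠ 0 := sub_ne_zero.2 (hne1 hr).symm
    have h2 := hne0 hr
    have h3 := eulerPoly_derivative_eval_ne_zero hr
    simp only [hc]
    rw [eulerPoly_succ_eval_of_root hr]
    field_simp
    ring
  have hder {x : ℝ} (hx : x ∈ Λ) (y : ℝ) : (derivative (eulerPoly n)).eval y =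
      (1 - x * y) * (q x).eval y - x * (y - x) * (q x).eval y +
        (y - x) * (1 - x * y) * (derivative (q x)).eval y := by
    rw [(hq x hx).1]
    simp
    ring
  have hqzero {x y : ℝ} (hx : x ∈ Λ) (hy : (eulerPoly n).eval y = 0) (h1 : y - x ≠ 0)
      (h2 : 1 - x * y ≠ 0) : (q x).eval y = 0 := by
    rw [(hq x hx).1] at hy
    simpa [h1, h2] using hy
  have hinside {y : ℝ} (hy : y ∈ Λ) : W.eval y = 0 := by
    have hr := ((hmem y).1 hy).1
    have hs : ∑ x ∈ Λ, c x * (q x).eval y = c y * (q y).eval y := by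
      refine Finset.sum_eq_single y (fun x hx hxy => ?_) (fun h => absurd hy h)
      rw [hqzero hx hr (sub_ne_zero.2 hxy.symm) ?_, mul_zero]
      have h1 := ((hmem x).1 hx).2
      have h2 := ((hmem y).1 hy).2
      have h3 : |x * y| < 1 := by
        rw [abs_mul]
        nlinarith [abs_nonneg x, abs_nonneg y]
      linarith [abs_lt.1 h3]
    simp only [hW, eval_sub, eval_add, eval_mul, eval_pow, eval_X, eval_finsetSum, eval_C, hs, hr,
      eval_one, zero_mul, add_zero]
    have h1 := hcx hy
    rw [hder hy y] at h1
    refine mul_right_cancel₀ (hsq hy) ?_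
    linear_combination h1
  have houtside {y : ℝ} (hy : y ∈ Λ) : W.eval y⁻¹ = 0 := by
    have hr := ((hmem y).1 hy).1
    have hy0 := hne0 hr
    have hr' := eulerPoly_eval_inv_eq_zero hr
    have hs : ∑ x ∈ Λ, c x * (q x).eval y⁻¹ = c y * (q y).eval y⁻¹ := by
      refine Finset.sum_eq_single y (fun x hx hxy => ?_) (fun h => absurd hy h)
      rw [hqzero hx hr' ?_ ?_, mul_zero]
      · intro h
        have h1 := ((hmem x).1 hx).2
        have h2 := ((hmem y).1 hy).2
        rw [← sub_eq_zero.1 h, abs_inv] at h1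
        exact absurd h1 (not_lt.2 (one_le_inv_iff₀.2 ⟨abs_pos.2 hy0, h2.le⟩))
      · intro h
        field_simp at h
        exact hxy (by linarith)
    simp only [hW, eval_sub, eval_add, eval_mul, eval_pow, eval_X, eval_finsetSum, eval_C, hs, hr',
      eval_one, zero_mul, add_zero]
    have h1 := hcx hy
    have h2 := eulerPoly_derivative_eval_inv hr
    rw [hder hy y⁻¹, mul_inv_cancel₀ hy0] at h2
    have h3 : 1 - y⁻¹ = -((1 - y) / y) := by
      field_simp
      ring
    rw [h3, (hn.add even_two).neg_pow, div_pow, sub_eq_zero, eq_div_iff (pow_ne_zero _ hy0)]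
    refine mul_right_cancel₀ (hsq hy) ?_
    have h4 : y * (y⁻¹ - y) = 1 - y ^ 2 := by
      field_simp
    rw [h4] at h2
    rw [pow_add y n 2, inv_pow]
    have h5 : (y ^ 2)⁻¹ * y ^ 2 = 1 := inv_mul_cancel₀ (pow_ne_zero _ hy0)
    linear_combination h1 - c y * h2 + c y * (q y).eval y⁻¹ * y ^ n * (1 - y ^ 2) * h5
  have hroot {y : ℝ} (hr : (eulerPoly n).eval y = 0) : W.eval y = 0 := by
    rcases lt_trichotomy |y| 1 with h | h | h
    · exact hinside ((hmem y).2 ⟨hr, h⟩)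
    · rcases eq_or_eq_neg_of_abs_eq h with rfl | rfl
      · exact absurd rfl (hne1 hr)
      · exact absurd hr (eulerPoly_eval_neg_one_ne_zero hn)
    · rw [← inv_inv y]
      refine houtside ((hmem _).2 ⟨eulerPoly_eval_inv_eq_zero hr, ?_⟩)
      rw [abs_inv]
      exact inv_lt_one_of_one_lt₀ h
  have hdeg : W.natDegree ≤ n := by
    have h1 : (X ^ 2 * ∑ x ∈ Λ, C (c x) * q x).natDegree ≤ n := by
      refine natDegree_mul_le.trans ?_
      have : (∑ x ∈ Λ, C (c x) * q x).natDegree ≤ n - 2 := by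
        refine natDegree_sum_le_of_forall_le _ _ fun x hx => (natDegree_C_mul_le _ _).trans ?_
        have := (hq x hx).2
        omega
      rw [natDegree_X_pow]
      omega
    have h2 : (eulerPoly n * (X ^ 2 + 1 - C (2 ^ (n + 1)) * X) - (1 - X) ^ (n + 2)).natDegree
        ≤ n := by
      refine natDegree_le_iff_coeff_eq_zero.2 fun i hi => ?_
      obtain ⟨j, rfl⟩ : ∃ j, i = j + 2 := ⟨i - 2, by omega⟩
      have e1 : eulerPoly n * (X ^ 2 + 1 - C (2 ^ (n + 1)) * X) =
          eulerPoly n * X ^ 2 + eulerPoly n - C (2 ^ (n + 1)) * (eulerPoly n * X) := by ring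
      have e2 : (1 - X : ℝ[X]) ^ (n + 2) = (X + C (-1)) ^ (n + 2) := by
        rw [← (hn.add even_two).neg_pow]
        congr 1
        simp
        ring
      rw [e1, e2, coeff_sub, coeff_sub, coeff_add, coeff_mul_X_pow, coeff_C_mul, coeff_mul_X,
        coeff_X_add_C_pow, coeff_eulerPoly, coeff_eulerPoly, coeff_eulerPoly,
        eulerCoeff_eq_zero hi]
      obtain h | h | h : j + 1 = n ∨ j = n ∨ n < j := by omega
      · subst h
        rw [eulerCoeff_symm (show j + 1 = j + 1 from rfl), eulerCoeff_one_right,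
          eulerCoeff_symm (show j + 1 + 0 = j + 1 from rfl), eulerCoeff_zero_right,
          Nat.choose_symm_of_eq_add (show j + 1 + 2 = (j + 2) + 1 from rfl)]
        have : j + 1 + 2 - (j + 2) = 1 := by omega
        rw [this]
        push_cast
        simp
      · subst h
        rw [eulerCoeff_symm (show j + 0 = j from rfl), eulerCoeff_zero_right,
          eulerCoeff_eq_zero (Nat.lt_succ_self j)]
        simp
      · rw [eulerCoeff_eq_zero h, eulerCoeff_eq_zero (h.trans (Nat.lt_succ_self j)),
          Nat.choose_eq_zero_of_lt (by omega)]
        simp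
    rw [hW, add_sub_assoc]
    exact natDegree_add_le_of_degree_le h1 h2
  refine eq_zero_of_natDegree_lt_card_of_eval_eq_zero' W
    (insert 0 (eulerPoly n).roots.toFinset) (fun y hy => ?_) ?_
  · rcases Finset.mem_insert.1 hy with rfl | hy
    · simp [hW, eulerPoly_eval_zero]
    · rw [Multiset.mem_toFinset, mem_roots (eulerPoly_ne_zero n), IsRoot.def] at hy
      exact hroot hy
  · rw [Finset.card_insert_of_notMem]
    · exact Nat.lt_succ_of_le (hdeg.trans (le_card_roots_eulerPoly n))
    · rw [Multiset.mem_toFinset, mem_roots (eulerPoly_ne_zero n), IsRoot.def, eulerPoly_eval_zero]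
      exact one_ne_zero

end EulerFrobenius

section LatticeSum

open Polynomial

lemma eval_taylor_sub_one_pow (n : ℕ) (f : ℝ[X]) :
    (fun x => ((((taylor 1 : Module.End ℝ ℝ[X]) - 1) ^ n) f).eval x) =
      (fwdDiff 1)^[n] (fun x => f.eval x) := by
  induction n with
  | zero => simp
  | succ n ih =>
    rw [Function.iterate_succ_apply', ← ih]
    funext x
    simp [pow_succ', fwdDiff, taylor_eval]

lemma taylor_sub_one_pow_X_pow_eq_zero {k n : ℕ} (h : k < n) :
    (((taylor 1 : Module.End ℝ ℝ[X]) - 1) ^ n) (X ^ k) = 0 := by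
  refine Polynomial.funext fun x => ?_
  have := congrFun (eval_taylor_sub_one_pow n (X ^ k)) x
  simp only [eval_pow, eval_X, fwdDiff_iter_pow_eq_zero_of_lt h] at this
  simpa using this

lemma taylor_sub_one_pow_X_pow_self (n : ℕ) :
    (((taylor 1 : Module.End ℝ ℝ[X]) - 1) ^ n) (X ^ n) = C (n.factorial : ℝ) := by
  refine Polynomial.funext fun x => ?_
  have := congrFun (eval_taylor_sub_one_pow n (X ^ n)) x
  simp only [eval_pow, eval_X, fwdDiff_iter_eq_factorial] at this
  simpa using this

lemma summable_pow_natAbs_mul_eval {x : ℝ} (hx : |x| < 1) (f : ℝ[X]) :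
    Summable fun β : ℤ => x ^ β.natAbs * f.eval (β : ℝ) := by
  have key (g : ℝ[X]) : Summable fun n : ℕ => x ^ n * g.eval (n : ℝ) := by
    simp_rw [eval_eq_sum_range, Finset.mul_sum]
    refine summable_sum fun i _ => ?_
    refine ((summable_pow_mul_geometric_of_norm_lt_one i (r := x) (by simpa using hx)).mul_left
      (g.coeff i)).congr fun n => by ring
  refine Summable.of_nat_of_neg ?_ ?_
  · simpa using key f
  · simpa using key (f.comp (-X))

/-- The sum of `x ^ |β| f(β)` over all integers `β`. -/
noncomputable def latticeSum (x : ℝ) (f : ℝ[X]) : ℝ :=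
  ∑' β : ℤ, x ^ β.natAbs * f.eval (β : ℝ)

lemma hasSum_latticeSum {x : ℝ} (hx : |x| < 1) (f : ℝ[X]) :
    HasSum (fun β : ℤ => x ^ β.natAbs * f.eval (β : ℝ)) (latticeSum x f) :=
  (summable_pow_natAbs_mul_eval hx f).hasSum

lemma pow_natAbs_three_term (x : ℝ) {β : ℤ} (hβ : β ≠ 0) :
    (1 + x ^ 2) * x ^ β.natAbs - x * x ^ (β + 1).natAbs - x * x ^ (β - 1).natAbs = 0 := by
  obtain ⟨n, rfl | rfl⟩ : ∃ n : ℕ, β = n + 1 ∨ β = -(n + 1) := ⟨β.natAbs - 1, by omega⟩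
  · rw [show ((n : ℤ) + 1).natAbs = n + 1 by omega, show ((n : ℤ) + 1 + 1).natAbs = n + 2 by omega,
      show ((n : ℤ) + 1 - 1).natAbs = n by omega]
    ring
  · rw [show (-((n : ℤ) + 1)).natAbs = n + 1 by omega, show (-((n : ℤ) + 1) + 1).natAbs = n by omega,
      show (-((n : ℤ) + 1) - 1).natAbs = n + 2 by omega]
    ring

lemma latticeSum_aeval_taylor {x : ℝ} (hx : |x| < 1) (f : ℝ[X]) :
    latticeSum x (aeval (taylor 1 : Module.End ℝ ℝ[X]) ((X - C x) * (1 - C x * X)) f) =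
      (1 - x ^ 2) * f.eval 1 := by
  have h0 := (hasSum_latticeSum hx (taylor 1 f)).mul_left (1 + x ^ 2)
  have h1 := ((Equiv.addRight (1 : ℤ)).hasSum_iff.2 (hasSum_latticeSum hx f)).mul_left x
  have h2 := ((Equiv.addRight (-1 : ℤ)).hasSum_iff.2
    (hasSum_latticeSum hx (taylor 2 f))).mul_left x
  have h3 : HasSum (fun β : ℤ => ((1 + x ^ 2) * x ^ β.natAbs - x * x ^ (β + 1).natAbs -
      x * x ^ (β - 1).natAbs) * f.eval ((β : ℝ) + 1)) ((1 - x ^ 2) * f.eval 1) := by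
    convert hasSum_single (0 : ℤ) (fun β hβ => ?_) using 1
    · simp
      left
      ring
    · rw [pow_natAbs_three_term x hβ, zero_mul]
  have h4 := (h0.sub h1).sub h2
  have h5 := h3.unique (h4.congr_fun fun β => ?_)
  · have h6 := (((hasSum_latticeSum hx (taylor 1 f)).mul_left (1 + x ^ 2)).sub
      ((hasSum_latticeSum hx f).mul_left x)).sub ((hasSum_latticeSum hx (taylor 2 f)).mul_left x)
    rw [h5]
    refine (hasSum_latticeSum hx _).unique (h6.congr_fun fun β => ?_)
    have e : (X - C x) * (1 - C x * X) = C (1 + x ^ 2) * X - C x - C x * X ^ 2 := by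
      simp only [C_add, C_pow, C_1]
      ring
    rw [e]
    simp [taylor_eval, pow_two, add_assoc, one_add_one_eq_two, Algebra.algebraMap_eq_smul_one]
    ring
  · simp only [Function.comp_apply, Equiv.coe_addRight, taylor_eval]
    push_cast
    rw [show (β : ℝ) + -1 + 2 = β + 1 by ring, ← sub_eq_add_neg]
    ring

lemma aeval_taylor_C (p : ℝ[X]) (c : ℝ) :
    aeval (taylor 1 : Module.End ℝ ℝ[X]) p (C c) = C (p.eval 1 * c) := by
  induction p using Polynomial.induction_on' with
  | add p q hp hq => simp [hp, hq, add_mul]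
  | monomial n a =>
    have (n : ℕ) : ((taylor 1 : Module.End ℝ ℝ[X]) ^ n) (C c) = C c := by
      induction n with
      | zero => simp
      | succ n ih => rw [pow_succ', Module.End.mul_apply, ih, taylor_C]
    simp [aeval_monomial, this, Algebra.algebraMap_eq_smul_one, smul_eq_C_mul]

end LatticeSum

section DiscreteOperator

open Polynomial

lemma isCoprime_eulerPoly_X_sub_one_pow (n k : ℕ) :
    IsCoprime (eulerPoly n) ((X - 1 : ℝ[X]) ^ k) := by
  refine IsCoprime.pow_right (IsCoprime.symm ?_)
  rw [← C_1, (irreducible_X_sub_C (1 : ℝ)).coprime_iff_not_dvd, dvd_iff_isRoot, IsRoot.def,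
    eulerPoly_eval_one]
  exact Nat.cast_ne_zero.2 (Nat.factorial_ne_zero _)

/-- The moments of the inverse Laurent sequence of `z E_n(z) / (1 - z) ^ (n + 2)`. -/
lemma hasSum_eulerFrobenius_moment {n k : ℕ} (hn : Even n) (hn2 : 2 ≤ n) (hk : k ≤ n + 2) :
    HasSum (fun β : ℤ => (∑ x ∈ (eulerPoly n).roots.toFinset.filter (fun x => |x| < 1),
        (1 - x) ^ (n + 3) / (x * (eulerPoly (n + 1)).eval x) * x ^ β.natAbs +
          (if β = 1 then 1 else 0) + (if β = -1 then 1 else 0) -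
          (if β = 0 then 2 ^ (n + 1) else 0)) * (β : ℝ) ^ k)
      (if k = n + 2 then (n + 2 : ℝ) else 0) := by
  obtain ⟨q, hq, hid⟩ := exists_partialFraction hn hn2
  set Λ := (eulerPoly n).roots.toFinset.filter (fun x => |x| < 1) with hΛ
  set a : ℝ → ℝ := fun x => (1 - x) ^ (n + 3) / (x * (eulerPoly (n + 1)).eval x) with ha
  have hlt {x : ℝ} (hx : x ∈ Λ) : |x| < 1 := (Finset.mem_filter.1 hx).2
  let T : Module.End ℝ ℝ[X] := taylor 1
  have hsum (f : ℝ[X]) : HasSum (fun β : ℤ => (∑ x ∈ Λ, a x * x ^ β.natAbs +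
          (if β = 1 then 1 else 0) + (if β = -1 then 1 else 0) -
          (if β = 0 then 2 ^ (n + 1) else 0)) * f.eval (β : ℝ))
      (∑ x ∈ Λ, a x * latticeSum x f + f.eval 1 + f.eval (-1) - 2 ^ (n + 1) * f.eval 0) := by
    have hs : HasSum (fun β : ℤ => ∑ x ∈ Λ, a x * (x ^ β.natAbs * f.eval (β : ℝ)))
        (∑ x ∈ Λ, a x * latticeSum x f) :=
      hasSum_sum fun x hx => (hasSum_latticeSum (hlt hx) f).mul_left _
    have hd (i : ℤ) (c : ℝ) : HasSum (fun β : ℤ => (if β = i then c else 0) * f.eval (β : ℝ))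
        (c * f.eval (i : ℝ)) := by
      convert hasSum_single i (fun β hβ => ?_) using 1
      · simp
      · simp [hβ]
    have := ((hs.add (hd 1 1)).add (hd (-1) 1)).sub (hd 0 (2 ^ (n + 1)))
    push_cast at this
    rw [one_mul, one_mul] at this
    refine this.congr_fun fun β => ?_
    simp only [sub_mul, add_mul, Finset.sum_mul, mul_assoc]
  have hconv (g : ℝ[X]) : ∑ x ∈ Λ, a x * latticeSum x (aeval T (eulerPoly n) g) +
      (aeval T (eulerPoly n) g).eval 1 + (aeval T (eulerPoly n) g).eval (-1) -
        2 ^ (n + 1) * (aeval T (eulerPoly n) g).eval 0 = (((T - 1) ^ (n + 2)) g).eval (-1) := by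
    have h1 : ∑ x ∈ Λ, a x * latticeSum x (aeval T (eulerPoly n) g) =
        ∑ x ∈ Λ, a x * (1 - x ^ 2) * (aeval T (q x) g).eval 1 := by
      refine Finset.sum_congr rfl fun x hx => ?_
      rw [mul_assoc, ← latticeSum_aeval_taylor (hlt hx), ← Module.End.mul_apply, ← map_mul,
        ← hq x hx]
    change X ^ 2 * ∑ x ∈ Λ, C (a x * (1 - x ^ 2)) * q x + _ = _ at hid
    obtain ⟨d, hd⟩ : ∃ d : ℝ → ℝ, ∀ x, a x * (1 - x ^ 2) = d x := ⟨_, fun _ => rfl⟩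
    simp only [hd] at hid h1
    generalize (2 : ℝ) ^ (n + 1) = c at hid ⊢
    have h2 := congrArg (fun p => (aeval T p g).eval (-1)) hid
    have h3 : aeval T ((1 - X : ℝ[X]) ^ (n + 2)) = (T - 1) ^ (n + 2) := by
      rw [← (hn.add even_two).neg_pow]
      simp
    have h4 (f : ℝ[X]) : (T f).eval (-1) = f.eval 0 := by simp [T, taylor_eval]
    have h5 (f : ℝ[X]) : (T f).eval 0 = f.eval 1 := by simp [T, taylor_eval]
    rw [h1, ← h3, ← h2, mul_comm (eulerPoly n)]
    simp only [map_add, map_mul, map_sub, aeval_X, aeval_C, map_one, map_sum,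
      Module.End.mul_apply, LinearMap.add_apply, LinearMap.sub_apply, pow_two,
      LinearMap.sum_apply, Module.End.one_apply, eval_add, eval_sub, h4, h5, eval_finsetSum,
      Module.algebraMap_end_apply, eval_smul, smul_eq_mul]
    ring
  obtain ⟨A, B, hAB⟩ := isCoprime_eulerPoly_X_sub_one_pow n (n + 3)
  have hT (i : ℕ) : aeval T ((X - 1 : ℝ[X]) ^ i) = (T - 1) ^ i := by simp
  have hX : aeval T (eulerPoly n) (aeval T A (X ^ k)) = X ^ k := by
    have h1 := congrArg (fun p => aeval T p (X ^ k)) hAB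
    rw [mul_comm A] at h1
    simpa [hT, T, taylor_sub_one_pow_X_pow_eq_zero (show k < n + 3 by omega)] using h1
  have hval : (((T - 1) ^ (n + 2)) (aeval T A (X ^ k))).eval (-1) =
      if k = n + 2 then (n + 2 : ℝ) else 0 := by
    rw [← hT, ← Module.End.mul_apply, ← map_mul, mul_comm, map_mul, Module.End.mul_apply, hT]
    split_ifs with h
    · have hA := congrArg (eval 1) hAB
      simp only [eval_add, eval_mul, eval_pow, eval_sub, eval_X, eval_one, sub_self, ne_eq,
        Nat.add_eq_zero_iff, OfNat.ofNat_ne_zero, and_false, not_false_eq_true, zero_pow, mul_zero,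
        add_zero, eulerPoly_eval_one] at hA
      rw [h, taylor_sub_one_pow_X_pow_self, aeval_taylor_C, eval_C, Nat.factorial_succ]
      push_cast
      linear_combination ((n : ℝ) + 2) * hA
    · rw [taylor_sub_one_pow_X_pow_eq_zero (by omega), map_zero, eval_zero]
  have := hsum (X ^ k)
  rw [← hval, ← hconv, hX]
  simpa using this

lemma Dm_eq {n m : ℕ} (h : ℝ) (hnm : 2 * m = n + 2) (β : ℤ) :
    Dm m h β = ((n + 1).factorial : ℝ) / h ^ (n + 2) *
      (∑ x ∈ (eulerPoly n).roots.toFinset.filter (fun x => |x| < 1),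
        (1 - x) ^ (n + 3) / (x * (eulerPoly (n + 1)).eval x) * x ^ β.natAbs +
          (if β = 1 then 1 else 0) + (if β = -1 then 1 else 0) -
          (if β = 0 then 2 ^ (n + 1) else 0)) := by
  have h0 {x : ℝ} (hx : x ∈ (eulerPoly n).roots.toFinset.filter (fun x => |x| < 1)) : x ≠ 0 := by
    rintro rfl
    rw [Finset.mem_filter, Multiset.mem_toFinset, mem_roots (eulerPoly_ne_zero n), IsRoot.def,
      eulerPoly_eval_zero] at hx
    exact one_ne_zero hx.1
  rw [Dm, smallRoots, hnm, show n + 2 - 1 = n + 1 by omega, show n + 2 - 2 = n by omega]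
  congr 1
  by_cases hβ0 : β = 0
  · simp [hβ0]
    ring
  by_cases hβ1 : β.natAbs = 1
  · have e : ∑ x ∈ (eulerPoly n).roots.toFinset.filter (fun x => |x| < 1),
        (1 - x) ^ (n + 3) / (x * (eulerPoly (n + 1)).eval x) * x =
        ∑ x ∈ (eulerPoly n).roots.toFinset.filter (fun x => |x| < 1),
          (1 - x) ^ (n + 3) / (eulerPoly (n + 1)).eval x :=
      Finset.sum_congr rfl fun x hx => by
        rw [div_mul_eq_mul_div, mul_comm x, mul_div_mul_right _ _ (h0 hx)]
    rcases Int.natAbs_eq_iff.1 hβ1 with rfl | rfl <;> simp [e, add_comm _ (1 : ℝ)]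
  · rw [if_neg hβ0, if_neg hβ1, if_neg (by omega), if_neg (by omega), if_neg hβ0]
    simp only [add_zero, sub_zero]
    exact Finset.sum_congr rfl fun x _ => by ring

end DiscreteOperator

theorem Dm_mul_monomial_sum (m : ℕ) (hm : 2 ≤ m) (h : ℝ) (hh : 0 < h)
    (k : ℕ) (hk : k ≤ 2 * m) :
    Summable (fun β : ℤ => Dm m h β * (h * (β : ℝ)) ^ k) ∧
    (k ≤ 2 * m - 1 → ∑' β : ℤ, Dm m h β * (h * (β : ℝ)) ^ k = 0) ∧
    (k = 2 * m → ∑' β : ℤ, Dm m h β * (h * (β : ℝ)) ^ k = ((2 * m).factorial : ℝ)) := by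
  obtain ⟨n, hn⟩ : ∃ n, 2 * m = n + 2 := ⟨2 * m - 2, by omega⟩
  have hsum : HasSum (fun β : ℤ => Dm m h β * (h * (β : ℝ)) ^ k)
      (((n + 1).factorial : ℝ) / h ^ (n + 2) * h ^ k * (if k = n + 2 then (n + 2 : ℝ) else 0)) := by
    refine ((hasSum_eulerFrobenius_moment (n := n) (k := k) ⟨m - 1, by omega⟩ (by omega)
      (by omega)).mul_left (((n + 1).factorial : ℝ) / h ^ (n + 2) * h ^ k)).congr_fun fun β => ?_
    rw [Dm_eq h hn, mul_pow]
    ring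
  refine ⟨hsum.summable, fun hk' => ?_, fun hk' => ?_⟩
  · rw [hsum.tsum_eq, if_neg (by omega), mul_zero]
  · rw [hsum.tsum_eq, if_pos (by omega), hk', hn, Nat.factorial_succ (n + 1),
      div_mul_cancel₀ _ (pow_ne_zero _ hh.ne')]
    push_cast
    ring
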